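/- arXiv:2505.16843 — 2 statements merged into one kernel-verified Lean document; each statement's English description precedes it below -/
import Mathlib

section
/- Let d ≥ 1, let s ∈ (0,∞)^d with ‖s‖ < 1, and let β > d/(1 − ‖s‖²). Define ψ(x,y) = (β/2)‖x‖² + β⟨s, y⟩ + (d/2) ln(1 − ‖x‖² − ‖y‖²) on the open Euclidean unit ball B_{2d}(0,1) ⊂ ℝ^d × ℝ^d. Then the set of global maximizing points of ψ on B_{2d}(0,1) is exactly { (sqrt(1 − d/β − ‖s‖²) · Ω, s) : Ω ∈ S^{d−1} }, where S^{d−1} is the unit sphere of ℝ^d. -/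
open MeasureTheory Filter Topology

noncomputable def ip {d : ℕ} (x y : Fin d → ℝ) : ℝ := ∑ j, x j * y j

noncomputable def sampleMean (d : ℕ) (h : ℕ → Fin d → ℝ) (n : ℕ) : Fin d → ℝ :=
  fun j => (∑ i ∈ Finset.range n, h i j) / n

noncomputable def sampleStd (d : ℕ) (h : ℕ → Fin d → ℝ) (n : ℕ) : Fin d → ℝ :=
  fun j => Real.sqrt ((∑ i ∈ Finset.range n, (h i j) ^ 2) / n - (sampleMean d h n j) ^ 2)

/-- Membership in the open unit ball `B_{2d}(0,1) ⊂ ℝ^d × ℝ^d`. -/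
def inBall (d : ℕ) (x y : Fin d → ℝ) : Prop := ip x x + ip y y < 1

def ballSet (d : ℕ) : Set ((Fin d → ℝ) × (Fin d → ℝ)) := {p | inBall d p.1 p.2}

/-- The exponential tilting function with mean vector `m` and standard deviation vector `s`. -/
noncomputable def psi (d : ℕ) (β : ℝ) (m s : Fin d → ℝ) (x y : Fin d → ℝ) : ℝ :=
  β / 2 * ip x x + β * ip m x + β * ip s y + (d : ℝ) / 2 * Real.log (1 - ip x x - ip y y)
lemma ip_self_nonneg {d : ℕ} (x : Fin d → ℝ) : 0 ≤ ip x x :=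
  Finset.sum_nonneg fun j _ => mul_self_nonneg (x j)

lemma ip_self_eq_zero {d : ℕ} {x : Fin d → ℝ} (h : ip x x = 0) : x = 0 := by
  funext j
  have hj := (Finset.sum_eq_zero_iff_of_nonneg fun j _ => mul_self_nonneg (x j)).1 h j
    (Finset.mem_univ j)
  simpa using hj

lemma ip_mul_mul {d : ℕ} (r : ℝ) (x : Fin d → ℝ) :
    ip (fun j => r * x j) (fun j => r * x j) = r ^ 2 * ip x x := by
  simp only [ip, Finset.mul_sum]
  exact Finset.sum_congr rfl fun j _ => by ring

lemma ip_sub_self {d : ℕ} (x y : Fin d → ℝ) :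
    ip (x - y) (x - y) = ip x x - 2 * ip x y + ip y y := by
  simp only [ip, Finset.mul_sum, ← Finset.sum_sub_distrib, ← Finset.sum_add_distrib]
  exact Finset.sum_congr rfl fun j _ => by simp only [Pi.sub_apply]; ring

/-- Completing the square: with zero mean, `psi` is a concave function of the slack
`1 - ‖x‖² - ‖y‖²` minus a multiple of `‖s - y‖²`. -/
lemma psi_zero_eq (d : ℕ) {β : ℝ} (hβ : β ≠ 0) (s x y : Fin d → ℝ) :
    psi d β 0 s x y = β / 2 * (1 + ip s s - ip (s - y) (s - y) +
      (d / β * Real.log (1 - ip x x - ip y y) - (1 - ip x x - ip y y))) := by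
  have h0 : ip 0 x = 0 := by simp [ip]
  rw [psi, ip_sub_self, h0]
  field_simp
  ring

lemma mul_log_sub_le {t u : ℝ} (ht : 0 < t) (hu : 0 < u) :
    t * Real.log u - u ≤ t * Real.log t - t := by
  have h := mul_le_mul_of_nonneg_left (Real.log_le_sub_one_of_pos (div_pos hu ht)) ht.le
  rw [Real.log_div hu.ne' ht.ne', mul_sub, mul_sub, mul_div_cancel₀ _ ht.ne'] at h
  linarith

lemma eq_of_mul_log_sub_le {t u : ℝ} (ht : 0 < t) (hu : 0 < u)
    (hle : t * Real.log t - t ≤ t * Real.log u - u) : u = t := by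
  by_contra hne
  have hne1 : u / t ≠ 1 := fun h => hne ((div_eq_one_iff_eq ht.ne').1 h)
  have h := mul_lt_mul_of_pos_left (Real.log_lt_sub_one_of_pos (div_pos hu ht) hne1) ht
  rw [Real.log_div hu.ne' ht.ne', mul_sub, mul_sub, mul_div_cancel₀ _ ht.ne'] at h
  linarith

/-- In the ferromagnetic regime (m = 0, ‖s‖ < 1, β > d/(1-‖s‖²)), the set of global
maximizing points of the limiting exponential tilting function is exactly
{ (sqrt(1 - d/β - ‖s‖²)·Ω, s) : Ω ∈ S^{d-1} }. -/
theorem stmt1 (d : ℕ) (hd : 1 ≤ d) (s : Fin d → ℝ) (hspos : ∀ j, 0 < s j)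
    (hs1 : ip s s < 1) (β : ℝ) (hβ : (d : ℝ) / (1 - ip s s) < β) :
    {p : (Fin d → ℝ) × (Fin d → ℝ) | inBall d p.1 p.2 ∧
        ∀ x y : Fin d → ℝ, inBall d x y → psi d β 0 s x y ≤ psi d β 0 s p.1 p.2} =
      {p : (Fin d → ℝ) × (Fin d → ℝ) | ∃ Ω : Fin d → ℝ, ip Ω Ω = 1 ∧
        p.1 = (fun j => Real.sqrt (1 - (d : ℝ) / β - ip s s) * Ω j) ∧ p.2 = s} := by
  have hd0 : (0 : ℝ) < d := by exact_mod_cast hd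
  have hS : 0 < 1 - ip s s := by linarith
  have hβ0 : 0 < β := (div_pos hd0 hS).trans hβ
  set t : ℝ := (d : ℝ) / β with ht_def
  have ht : 0 < t := div_pos hd0 hβ0
  have htS : 0 < 1 - t - ip s s := by
    have h : t < 1 - ip s s := by
      rw [div_lt_iff₀ hS] at hβ
      rw [ht_def, div_lt_iff₀ hβ0]
      linarith
    linarith
  set r : ℝ := Real.sqrt (1 - t - ip s s)
  have hr : 0 < r := Real.sqrt_pos.2 htS
  have hr2 : r ^ 2 = 1 - t - ip s s := Real.sq_sqrt htS.le
  have hcrit (Ω : Fin d → ℝ) (hΩ : ip Ω Ω = 1) : inBall d (fun j => r * Ω j) s ∧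
      psi d β 0 s (fun j => r * Ω j) s = β / 2 * (1 + ip s s + (t * Real.log t - t)) := by
    have hslack : 1 - (1 - t - ip s s) * 1 - ip s s = t := by ring
    have hzero : ip (s - s) (s - s) = 0 := by simp [ip]
    constructor
    · rw [inBall, ip_mul_mul, hr2, hΩ]
      linarith
    · rw [psi_zero_eq d hβ0.ne', ip_mul_mul, hr2, hΩ, hslack, hzero, sub_zero]
  ext ⟨x, y⟩
  simp only [Set.mem_ofPred_eq]
  constructor
  · rintro ⟨hball, hmax⟩
    have hu : 0 < 1 - ip x x - ip y y := by
      rw [inBall] at hball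
      linarith
    obtain ⟨e, he⟩ : ∃ e : Fin d → ℝ, ip e e = 1 :=
      ⟨Pi.single ⟨0, hd⟩ 1, by simp [ip, Pi.single_apply]⟩
    have h := hmax _ _ (hcrit e he).1
    rw [(hcrit e he).2, psi_zero_eq d hβ0.ne'] at h
    have h' := le_of_mul_le_mul_left h (half_pos hβ0)
    have hlog := mul_log_sub_le ht hu
    have hsq := ip_self_nonneg (s - y)
    have hy : y = s := (sub_eq_zero.1 (ip_self_eq_zero (by linarith : ip (s - y) (s - y) = 0))).symm
    have hut := eq_of_mul_log_sub_le ht hu (by linarith)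
    subst hy
    refine ⟨fun j => r⁻¹ * x j, ?_, ?_, rfl⟩
    · have hx : ip x x = r ^ 2 := by linarith
      rw [ip_mul_mul, hx]
      field_simp
    · funext j
      field_simp
  · rintro ⟨Ω, hΩ, rfl, rfl⟩
    refine ⟨(hcrit Ω hΩ).1, fun x' y' hball => ?_⟩
    rw [(hcrit Ω hΩ).2, psi_zero_eq d hβ0.ne']
    have hu : 0 < 1 - ip x' x' - ip y' y' := by
      rw [inBall] at hball
      linarith
    refine mul_le_mul_of_nonneg_left ?_ (half_pos hβ0).le
    have hlog := mul_log_sub_le ht hu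
    have hsq := ip_self_nonneg (y - y')
    linarith
end

section
/- Let d ≥ 1, β > 0, and let h ∈ (ℝ^d)^ℕ be a field whose sample means converge, m_n → m ∈ ℝ^d, and whose sample standard deviations converge, s_n → s ∈ (0,∞)^d. Then for every Borel set B ⊂ B_{2d}(0,1) of positive finite Lebesgue measure such that sup_{(x,y) ∈ B} ψ^{β,h}(x,y) < sup_{(x,y) ∈ B_{2d}(0,1)} ψ^{β,h}(x,y), the mixing probability measures satisfy lim_{n→∞} α_n^{β,h}(B) = 0. -/
open MeasureTheory Filter Topology

/-- The mixing probability measure αₙ^{β,h} on B_{2d}(0,1), with density proportional to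
(1-‖x‖²-‖y‖²)^{-(d+1)} e^{n ψₙ^{β,h}(x,y)} with respect to Lebesgue measure. -/
noncomputable def mixMeasure (d : ℕ) (β : ℝ) (h : ℕ → Fin d → ℝ) (n : ℕ) :
    Measure ((Fin d → ℝ) × (Fin d → ℝ)) :=
  let ρ : Measure ((Fin d → ℝ) × (Fin d → ℝ)) :=
    (volume.restrict (ballSet d)).withDensity fun p =>
      ENNReal.ofReal (Real.exp (n * psi d β (sampleMean d h n) (sampleStd d h n) p.1 p.2) /
        (1 - ip p.1 p.1 - ip p.2 p.2) ^ (d + 1))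
  (ρ Set.univ)⁻¹ • ρ

lemma abs_le_one_of_ip_self_le_one {d : ℕ} {x : Fin d → ℝ} (hx : ip x x ≤ 1) (j : Fin d) :
    |x j| ≤ 1 := by
  have h : x j * x j ≤ ip x x :=
    Finset.single_le_sum (f := fun j => x j * x j) (fun j _ => mul_self_nonneg (x j))
      (Finset.mem_univ j)
  exact abs_le_one_iff_mul_self_le_one.mpr (h.trans hx)

lemma abs_ip_le_sum_abs {d : ℕ} (a : Fin d → ℝ) {x : Fin d → ℝ} (hx : ip x x ≤ 1) :
    |ip a x| ≤ ∑ j, |a j| := by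
  refine (Finset.abs_sum_le_sum_abs _ _).trans (Finset.sum_le_sum fun j _ => ?_)
  rw [abs_mul]
  exact mul_le_of_le_one_right (abs_nonneg _) (abs_le_one_of_ip_self_le_one hx j)

lemma ip_sub_left {d : ℕ} (a b x : Fin d → ℝ) : ip (a - b) x = ip a x - ip b x := by
  simp [ip, sub_mul]

lemma isOpen_ballSet (d : ℕ) : IsOpen (ballSet d) := by
  have h : Continuous fun p : (Fin d → ℝ) × (Fin d → ℝ) => ip p.1 p.1 + ip p.2 p.2 := by
    unfold ip
    fun_prop
  exact isOpen_lt h continuous_const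

lemma ip_self_le_one_of_mem_ballSet {d : ℕ} {p : (Fin d → ℝ) × (Fin d → ℝ)}
    (hp : p ∈ ballSet d) : ip p.1 p.1 ≤ 1 ∧ ip p.2 p.2 ≤ 1 := by
  have h : ip p.1 p.1 + ip p.2 p.2 < 1 := hp
  have h₁ := ip_self_nonneg p.1
  have h₂ := ip_self_nonneg p.2
  constructor <;> linarith

lemma continuousOn_psi (d : ℕ) (β : ℝ) (m s : Fin d → ℝ) :
    ContinuousOn (fun p : (Fin d → ℝ) × (Fin d → ℝ) => psi d β m s p.1 p.2) (ballSet d) := by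
  have h : ContinuousOn (fun p : (Fin d → ℝ) × (Fin d → ℝ) =>
      Real.log (1 - ip p.1 p.1 - ip p.2 p.2)) (ballSet d) := by
    refine ContinuousOn.log (Continuous.continuousOn ?_) fun p hp => ?_
    · unfold ip
      fun_prop
    · have hp' : ip p.1 p.1 + ip p.2 p.2 < 1 := hp
      linarith
  unfold psi
  refine ContinuousOn.add (Continuous.continuousOn ?_) (continuousOn_const.mul h)
  unfold ip
  fun_prop

/-- Weight of the quadratic and linear part of `psi`, an upper bound for it on the unit ball. -/
noncomputable def psiBound (d : ℕ) (β : ℝ) (m s : Fin d → ℝ) : ℝ :=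
  β / 2 + β * ∑ j, |m j| + β * ∑ j, |s j|

lemma psi_le_psiBound_add_log {d : ℕ} {β : ℝ} (hβ : 0 < β) (m s : Fin d → ℝ)
    {p : (Fin d → ℝ) × (Fin d → ℝ)} (hp : p ∈ ballSet d) :
    psi d β m s p.1 p.2 ≤
      psiBound d β m s + (d : ℝ) / 2 * Real.log (1 - ip p.1 p.1 - ip p.2 p.2) := by
  obtain ⟨hx, hy⟩ := ip_self_le_one_of_mem_ballSet hp
  unfold psi psiBound
  gcongr
  · nlinarith
  · exact (le_abs_self _).trans (abs_ip_le_sum_abs m hx)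
  · exact (le_abs_self _).trans (abs_ip_le_sum_abs s hy)

lemma psi_le_psiBound {d : ℕ} {β : ℝ} (hβ : 0 < β) (m s : Fin d → ℝ)
    {p : (Fin d → ℝ) × (Fin d → ℝ)} (hp : p ∈ ballSet d) :
    psi d β m s p.1 p.2 ≤ psiBound d β m s := by
  have hp' : ip p.1 p.1 + ip p.2 p.2 < 1 := hp
  have h₁ := ip_self_nonneg p.1
  have h₂ := ip_self_nonneg p.2
  have hlog : Real.log (1 - ip p.1 p.1 - ip p.2 p.2) ≤ 0 :=
    Real.log_nonpos (by linarith) (by linarith)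
  have hd : (0 : ℝ) ≤ (d : ℝ) / 2 := by positivity
  have := psi_le_psiBound_add_log hβ m s hp
  nlinarith

lemma bddAbove_psi_image {d : ℕ} {β : ℝ} (hβ : 0 < β) (m s : Fin d → ℝ)
    {B : Set ((Fin d → ℝ) × (Fin d → ℝ))} (hB : B ⊆ ballSet d) :
    BddAbove ((fun p : (Fin d → ℝ) × (Fin d → ℝ) => psi d β m s p.1 p.2) '' B) := by
  refine ⟨psiBound d β m s, ?_⟩
  rintro _ ⟨p, hp, rfl⟩
  exact psi_le_psiBound hβ m s (hB hp)

lemma abs_psi_sub_psi_le {d : ℕ} {β : ℝ} (hβ : 0 < β) (a b m s : Fin d → ℝ)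
    {p : (Fin d → ℝ) × (Fin d → ℝ)} (hp : p ∈ ballSet d) :
    |psi d β a b p.1 p.2 - psi d β m s p.1 p.2| ≤
      β * ∑ j, |a j - m j| + β * ∑ j, |b j - s j| := by
  obtain ⟨hx, hy⟩ := ip_self_le_one_of_mem_ballSet hp
  have h : psi d β a b p.1 p.2 - psi d β m s p.1 p.2 =
      β * ip (a - m) p.1 + β * ip (b - s) p.2 := by
    rw [ip_sub_left, ip_sub_left]
    unfold psi
    ring
  rw [h]
  refine (abs_add_le _ _).trans ?_
  rw [abs_mul, abs_mul, abs_of_pos hβ]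
  gcongr
  · exact abs_ip_le_sum_abs (a - m) hx
  · exact abs_ip_le_sum_abs (b - s) hy

/-- Uniform convergence of the tilting functions on the unit ball. -/
lemma eventually_abs_psi_sub_psi_le {d : ℕ} {β : ℝ} (hβ : 0 < β) {a b : ℕ → Fin d → ℝ}
    {m s : Fin d → ℝ} (ha : Tendsto a atTop (𝓝 m)) (hb : Tendsto b atTop (𝓝 s))
    {ε : ℝ} (hε : 0 < ε) :
    ∀ᶠ n in atTop, ∀ p ∈ ballSet d,
      |psi d β (a n) (b n) p.1 p.2 - psi d β m s p.1 p.2| ≤ ε := by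
  have key : ∀ {u : ℕ → Fin d → ℝ} {v : Fin d → ℝ}, Tendsto u atTop (𝓝 v) →
      Tendsto (fun n => β * ∑ j, |u n j - v j|) atTop (𝓝 0) := by
    intro u v huv
    have hc : Continuous fun w : Fin d → ℝ => β * ∑ j, |w j - v j| := by fun_prop
    simpa [Function.comp_def] using (hc.tendsto v).comp huv
  have hlim := (key ha).add (key hb)
  rw [add_zero] at hlim
  filter_upwards [hlim.eventually_lt_const hε] with n hn p hp
  exact (abs_psi_sub_psi_le hβ _ _ _ _ hp).trans hn.le

lemma eventually_psiBound_lt {d : ℕ} (β : ℝ) {a b : ℕ → Fin d → ℝ}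
    {m s : Fin d → ℝ} (ha : Tendsto a atTop (𝓝 m)) (hb : Tendsto b atTop (𝓝 s)) :
    ∀ᶠ n in atTop, psiBound d β (a n) (b n) < psiBound d β m s + 1 := by
  have hc : Continuous fun w : (Fin d → ℝ) × (Fin d → ℝ) => psiBound d β w.1 w.2 := by
    unfold psiBound
    fun_prop
  exact ((hc.tendsto (m, s)).comp (ha.prodMk_nhds hb)).eventually_lt_const (lt_add_one _)

/-- Four powers of the exponential weight absorb the singularity at the boundary of the ball. -/
lemma exp_mul_psi_div_le {d : ℕ} (hd : 1 ≤ d) {β : ℝ} (hβ : 0 < β) {a b : Fin d → ℝ}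
    {p : (Fin d → ℝ) × (Fin d → ℝ)} (hp : p ∈ ballSet d) {n : ℕ} (hn : 4 ≤ n) {K c : ℝ}
    (hK : psiBound d β a b ≤ K) (hc : psi d β a b p.1 p.2 ≤ c) :
    Real.exp (n * psi d β a b p.1 p.2) / (1 - ip p.1 p.1 - ip p.2 p.2) ^ (d + 1) ≤
      Real.exp (4 * K + (n - 4) * c) := by
  have hp' : ip p.1 p.1 + ip p.2 p.2 < 1 := hp
  have h₁ := ip_self_nonneg p.1
  have h₂ := ip_self_nonneg p.2
  have hψ := psi_le_psiBound_add_log hβ a b hp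
  set w := 1 - ip p.1 p.1 - ip p.2 p.2 with hw
  have hw0 : 0 < w := by linarith
  have hlog : Real.log w ≤ 0 := Real.log_nonpos hw0.le (by linarith)
  have hpow : w ^ (d + 1) = Real.exp ((d + 1 : ℕ) * Real.log w) := by
    rw [Real.exp_nat_mul, Real.exp_log hw0]
  rw [hpow, ← Real.exp_sub]
  gcongr
  have hn' : (4 : ℝ) ≤ n := by exact_mod_cast hn
  have hd' : (1 : ℝ) ≤ d := by exact_mod_cast hd
  push_cast
  nlinarith [mul_le_mul_of_nonneg_left hc (sub_nonneg.mpr hn'),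
    mul_nonneg (sub_nonneg.mpr hd') (neg_nonneg.mpr hlog)]

lemma exp_le_exp_mul_psi_div {d : ℕ} {β : ℝ} {a b : Fin d → ℝ}
    {p : (Fin d → ℝ) × (Fin d → ℝ)} (hp : p ∈ ballSet d) (n : ℕ) {c : ℝ}
    (hc : c ≤ psi d β a b p.1 p.2) :
    Real.exp (n * c) ≤
      Real.exp (n * psi d β a b p.1 p.2) / (1 - ip p.1 p.1 - ip p.2 p.2) ^ (d + 1) := by
  have hp' : ip p.1 p.1 + ip p.2 p.2 < 1 := hp
  have h₁ := ip_self_nonneg p.1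
  have h₂ := ip_self_nonneg p.2
  have hw0 : 0 < 1 - ip p.1 p.1 - ip p.2 p.2 := by linarith
  have hw1 : 1 - ip p.1 p.1 - ip p.2 p.2 ≤ 1 := by linarith
  rw [le_div_iff₀ (pow_pos hw0 _)]
  calc Real.exp (n * c) * (1 - ip p.1 p.1 - ip p.2 p.2) ^ (d + 1)
      ≤ Real.exp (n * c) * 1 := by
        gcongr
        exact pow_le_one₀ hw0.le hw1
    _ ≤ Real.exp (n * psi d β a b p.1 p.2) := by
        rw [mul_one]
        gcongr

/-- A normalized density that is at most `A` on `B` and at least `C` on `U` gives `B` mass at most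
`A / C` times the ratio of the volumes. -/
lemma mixMeasure_le_of_density_bounds {d : ℕ} {β : ℝ} {h : ℕ → Fin d → ℝ} {n : ℕ}
    {B U : Set ((Fin d → ℝ) × (Fin d → ℝ))} (hB : MeasurableSet B) (hU : MeasurableSet U)
    (hBsub : B ⊆ ballSet d) (hUsub : U ⊆ ballSet d) {A C : ℝ} (hC : 0 < C)
    (hBle : ∀ p ∈ B, Real.exp (n * psi d β (sampleMean d h n) (sampleStd d h n) p.1 p.2) /
      (1 - ip p.1 p.1 - ip p.2 p.2) ^ (d + 1) ≤ A)
    (hUge : ∀ p ∈ U, C ≤ Real.exp (n * psi d β (sampleMean d h n) (sampleStd d h n) p.1 p.2) /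
      (1 - ip p.1 p.1 - ip p.2 p.2) ^ (d + 1)) :
    mixMeasure d β h n B ≤ ENNReal.ofReal (A / C) * ((volume U)⁻¹ * volume B) := by
  unfold mixMeasure
  set f : (Fin d → ℝ) × (Fin d → ℝ) → ENNReal := fun p =>
    ENNReal.ofReal (Real.exp (n * psi d β (sampleMean d h n) (sampleStd d h n) p.1 p.2) /
      (1 - ip p.1 p.1 - ip p.2 p.2) ^ (d + 1)) with hf
  set ρ := (volume.restrict (ballSet d)).withDensity f with hρ
  have hρB : ρ B ≤ ENNReal.ofReal A * volume B := by
    rw [hρ, withDensity_apply _ hB, Measure.restrict_restrict hB,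
      Set.inter_eq_left.mpr hBsub, ← setLIntegral_const]
    exact setLIntegral_mono' hB fun p hp => ENNReal.ofReal_le_ofReal (hBle p hp)
  have hρU : ENNReal.ofReal C * volume U ≤ ρ Set.univ := by
    refine le_trans ?_ (measure_mono (Set.subset_univ U))
    rw [hρ, withDensity_apply _ hU, Measure.restrict_restrict hU,
      Set.inter_eq_left.mpr hUsub, ← setLIntegral_const]
    exact setLIntegral_mono' hU fun p hp => ENNReal.ofReal_le_ofReal (hUge p hp)
  have hC0 : ENNReal.ofReal C ≠ 0 := by simpa using hC
  calc (ρ Set.univ)⁻¹ * ρ B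
      ≤ (ENNReal.ofReal C * volume U)⁻¹ * (ENNReal.ofReal A * volume B) := by gcongr
    _ = ENNReal.ofReal (A / C) * ((volume U)⁻¹ * volume B) := by
        rw [ENNReal.mul_inv (Or.inl hC0) (Or.inl ENNReal.ofReal_ne_top),
          ENNReal.ofReal_div_of_pos hC, div_eq_mul_inv]
        ring

/-- Concentration of the mixing measures: sets on which the limiting tilting function is
strictly below its supremum are asymptotically negligible. -/
theorem stmt5 (d : ℕ) (hd : 1 ≤ d) (β : ℝ) (hβ : 0 < β) (h : ℕ → Fin d → ℝ)
    (m s : Fin d → ℝ)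
    (hm : Tendsto (sampleMean d h) atTop (𝓝 m))
    (hs : Tendsto (sampleStd d h) atTop (𝓝 s))
    (hspos : ∀ j, 0 < s j)
    (B : Set ((Fin d → ℝ) × (Fin d → ℝ))) (hB : MeasurableSet B)
    (hBsub : B ⊆ ballSet d) (hpos : 0 < volume B) (hfin : volume B < ⊤)
    (hsup : sSup ((fun p : (Fin d → ℝ) × (Fin d → ℝ) => psi d β m s p.1 p.2) '' B) <
      sSup ((fun p : (Fin d → ℝ) × (Fin d → ℝ) => psi d β m s p.1 p.2) '' ballSet d)) :
    Tendsto (fun n : ℕ => (mixMeasure d β h n B).toReal) atTop (𝓝 0) := by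
  set F : (Fin d → ℝ) × (Fin d → ℝ) → ℝ := fun p => psi d β m s p.1 p.2 with hF
  set b := sSup (F '' B)
  set S := sSup (F '' ballSet d)
  obtain ⟨ε, hε, hgap⟩ : ∃ ε > 0, S - b = 4 * ε := ⟨(S - b) / 4, by linarith, by ring⟩
  let U := ballSet d ∩ F ⁻¹' Set.Ioi (S - ε)
  have hUopen : IsOpen U := (continuousOn_psi d β m s).isOpen_inter_preimage
    (isOpen_ballSet d) isOpen_Ioi
  have hUne : U.Nonempty := by
    have hne : (F '' ballSet d).Nonempty :=
      ((nonempty_of_measure_ne_zero hpos.ne').mono hBsub).image F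
    obtain ⟨_, ⟨p, hp, rfl⟩, hlt⟩ := exists_lt_of_lt_csSup hne (sub_lt_self S hε)
    exact ⟨p, hp, hlt⟩
  have hvolU : volume U ≠ 0 := (hUopen.measure_pos volume hUne).ne'
  set K := psiBound d β m s + 1
  have hbound : ∀ᶠ n : ℕ in atTop, mixMeasure d β h n B ≤
      ENNReal.ofReal (Real.exp (4 * K + (n - 4) * (b + ε)) / Real.exp (n * (S - 2 * ε))) *
        ((volume U)⁻¹ * volume B) := by
    filter_upwards [eventually_abs_psi_sub_psi_le hβ hm hs hε, eventually_psiBound_lt β hm hs,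
      eventually_ge_atTop 4] with n hclose hK hn
    refine mixMeasure_le_of_density_bounds hB hUopen.measurableSet hBsub Set.inter_subset_left
      (Real.exp_pos _) (fun p hp => ?_) (fun p hp => ?_)
    · refine exp_mul_psi_div_le hd hβ (hBsub hp) hn hK.le ?_
      have h₁ := (abs_le.mp (hclose p (hBsub hp))).2
      have h₂ : F p ≤ b := le_csSup (bddAbove_psi_image hβ m s hBsub) ⟨p, hp, rfl⟩
      simp only [hF] at h₂
      linarith
    · refine exp_le_exp_mul_psi_div hp.1 n ?_
      have h₁ := (abs_le.mp (hclose p hp.1)).1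
      have h₂ : S - ε < F p := hp.2
      simp only [hF] at h₂
      linarith
  have hexp : Tendsto (fun n : ℕ =>
      Real.exp (4 * K + (n - 4) * (b + ε)) / Real.exp (n * (S - 2 * ε))) atTop (𝓝 0) := by
    have hlin : Tendsto (fun n : ℕ => 4 * K - 4 * (b + ε) + (n : ℝ) * (-ε)) atTop atBot :=
      tendsto_atBot_add_const_left _ _
        (tendsto_natCast_atTop_atTop.atTop_mul_const_of_neg (neg_lt_zero.mpr hε))
    refine (Real.tendsto_exp_atBot.comp hlin).congr fun n => ?_
    rw [Function.comp_apply, ← Real.exp_sub]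
    congr 1
    linear_combination (n : ℝ) * hgap
  have hlim : Tendsto (fun n : ℕ =>
      ENNReal.ofReal (Real.exp (4 * K + (n - 4) * (b + ε)) / Real.exp (n * (S - 2 * ε))) *
        ((volume U)⁻¹ * volume B)) atTop (𝓝 0) := by
    have hconst : (volume U)⁻¹ * volume B ≠ ⊤ :=
      ENNReal.mul_ne_top (ENNReal.inv_ne_top.mpr hvolU) hfin.ne
    simpa using ENNReal.Tendsto.mul_const (ENNReal.tendsto_ofReal hexp) (Or.inr hconst)
  have hmix : Tendsto (fun n : ℕ => mixMeasure d β h n B) atTop (𝓝 0) :=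
    tendsto_of_tendsto_of_tendsto_of_le_of_le' tendsto_const_nhds hlim
      (Eventually.of_forall fun _ => zero_le) hbound
  simpa [Function.comp_def] using (ENNReal.tendsto_toReal ENNReal.zero_ne_top).comp hmix
end
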